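/- Let M be a finitely generated conical refinement monoid and let p ∈ M be a free prime which is not minimal in the poset of primes of M. Choose representatives q_1, …, q_n of the classes in the lower cover of p̄, set s_p = q_1 + ⋯ + q_n, and let M_{J_p} be the archimedean component of s_p in M. Then for every x ∈ M_{J_p} the element p + x belongs to G'_p, and the map φ_p : M_{J_p} → G'_p, x ↦ p + x, is a surjective semigroup homomorphism onto the group G'_p. -/

import Mathlib

namespace ArPardo

/-- A countable row-finite directed graph `E = (E⁰, E¹, s, r)`. -/
structure RowFiniteGraph : Type 1 where
  V : Type
  E : Type
  countableV : Countable V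
  countableE : Countable E
  s : E → V
  r : E → V
  rowFinite : ∀ v : V, {e : E | s e = v}.Finite

/-- The defining relations of the graph monoid, as a relation on the free
commutative monoid `V →₀ ℕ` on the vertices: for every vertex `v` emitting
at least one edge, `a_v = Σ_{e ∈ s⁻¹(v)} a_{r(e)}`. -/
def graphRel (G : RowFiniteGraph) (x y : G.V →₀ ℕ) : Prop :=
  ∃ v : G.V, (∃ e : G.E, G.s e = v) ∧ x = Finsupp.single v 1 ∧
    y = ∑ e ∈ (G.rowFinite v).toFinset, Finsupp.single (G.r e) 1

/-- The graph monoid `M(E)`: the quotient of the free commutative monoid on the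
vertices by the congruence generated by the graph relations. -/
def graphMonoid (G : RowFiniteGraph) : Type :=
  (addConGen (graphRel G)).Quotient

noncomputable instance (G : RowFiniteGraph) : AddCommMonoid (graphMonoid G) :=
  inferInstanceAs (AddCommMonoid (addConGen (graphRel G)).Quotient)

/-- The canonical generator `a_v` of the graph monoid. -/
noncomputable def vertexElem (G : RowFiniteGraph) (v : G.V) : graphMonoid G :=
  (addConGen (graphRel G)).mk' (Finsupp.single v 1)

/-- A commutative monoid is a graph monoid if it is isomorphic to `M(E)` for some
(countable) row-finite directed graph `E`. -/
def IsGraphMonoid (M : Type) [AddCommMonoid M] : Prop :=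
  ∃ G : RowFiniteGraph, Nonempty (M ≃+ graphMonoid G)

/-- The algebraic preorder on a commutative monoid: `x ≤ y` iff `y = x + z`. -/
def algLE {M : Type} [AddCommMonoid M] (x y : M) : Prop :=
  ∃ z : M, y = x + z

/-- A commutative monoid is conical if `x + y = 0` implies `x = y = 0`. -/
def IsConical (M : Type) [AddCommMonoid M] : Prop :=
  ∀ x y : M, x + y = 0 → x = 0 ∧ y = 0

/-- The Riesz refinement property. -/
def IsRefinement (M : Type) [AddCommMonoid M] : Prop :=
  ∀ a b c d : M, a + b = c + d →
    ∃ w x y z : M, a = w + x ∧ b = y + z ∧ c = w + y ∧ d = x + z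

/-- A prime element: not invertible, and `p ≤ a + b` implies `p ≤ a` or `p ≤ b`. -/
def IsPrimeElem {M : Type} [AddCommMonoid M] (p : M) : Prop :=
  (∀ q : M, p + q ≠ 0) ∧ ∀ a b : M, algLE p (a + b) → algLE p a ∨ algLE p b

/-- A free element: `n • p ≤ m • p` implies `n ≤ m`. -/
def IsFreeElem {M : Type} [AddCommMonoid M] (p : M) : Prop :=
  ∀ n m : ℕ, algLE (n • p) (m • p) → n ≤ m

/-- A regular element: `2x ≤ x`. -/
def IsRegularElem {M : Type} [AddCommMonoid M] (x : M) : Prop :=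
  algLE (x + x) x

/-- `q̄ < p̄` in the poset of (classes of) elements: `q ≤ p` and `p ≰ q`. -/
def classLT {M : Type} [AddCommMonoid M] (q p : M) : Prop :=
  algLE q p ∧ ¬ algLE p q

/-- `q` is a prime whose class lies in the lower cover of the class of the prime `p`:
`q̄ < p̄` and no prime class lies strictly between. -/
def InLowerCover {M : Type} [AddCommMonoid M] (p q : M) : Prop :=
  IsPrimeElem q ∧ classLT q p ∧
    ¬ ∃ t : M, IsPrimeElem t ∧ classLT q t ∧ classLT t p

/-- `Q` is a (finite) set of representatives of the classes in the lower cover of `p̄`: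
its elements are in the lower cover, pairwise inequivalent, and every prime in the
lower cover is equivalent to one of them. -/
def IsLowerCoverReps {M : Type} [AddCommMonoid M] (p : M) (Q : Finset M) : Prop :=
  (∀ q ∈ Q, InLowerCover p q) ∧
  (∀ q ∈ Q, ∀ q' ∈ Q, algLE q q' → algLE q' q → q = q') ∧
  (∀ t : M, InLowerCover p t → ∃ q ∈ Q, algLE q t ∧ algLE t q)

/-- The underlying set of the group `G'_p = {p + α : α ∈ M, p + α ≤ p}`. -/
def GpSet {M : Type} [AddCommMonoid M] (p : M) : Set M :=
  {y | ∃ α : M, y = p + α ∧ algLE y p}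

/-- `j : G' → M` realizes the abelian group `G'` as the group
`G'_p = {p + α : p + α ≤ p}` with identity `p` and operation
`(p + α) ∘ (p + β) = p + (α + β)`. -/
structure GpStructure (M : Type) [AddCommMonoid M] (p : M)
    (G' : Type) [AddCommGroup G'] (j : G' → M) : Prop where
  inj : Function.Injective j
  range_eq : Set.range j = GpSet p
  map_zero : j 0 = p
  map_add : ∀ (u v : G') (α β : M), j u = p + α → j v = p + β → j (u + v) = p + (α + β)

/-- The archimedean component of `s`: all `a` with `a ≤ n • s` and `s ≤ m • a` for
some positive integers `n, m`; it is a subsemigroup. -/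
def archComp {M : Type} [AddCommMonoid M] (s : M) : AddSubsemigroup M where
  carrier := {a : M | ∃ n m : ℕ, 0 < n ∧ 0 < m ∧ algLE a (n • s) ∧ algLE s (m • a)}
  add_mem' := by
    rintro a b ⟨n, m, hn, hm, ⟨z, hz⟩, ⟨w, hw⟩⟩ ⟨n', m', hn', hm', ⟨z', hz'⟩, ⟨w', hw'⟩⟩
    refine ⟨n + n', m, Nat.add_pos_left hn _, hm, ⟨z + z', ?_⟩, ⟨w + m • b, ?_⟩⟩
    · rw [add_nsmul, hz, hz']; abel
    · rw [nsmul_add, hw]; abel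

/-- `(Γ, ι)` is a Grothendieck group of the commutative semigroup `S`: every
semigroup homomorphism from `S` to an abelian group factors uniquely through `ι`. -/
def IsGrothendieck (S : Type) [Add S] (Γ : Type) [AddCommGroup Γ] (ι : AddHom S Γ) : Prop :=
  ∀ (A : Type) [AddCommGroup A], ∀ f : AddHom S A, ∃! g : Γ →+ A, ∀ x : S, g (ι x) = f x

/-- The almost-isomorphism condition at a free prime `p`, with `Q` a set of
representatives of the lower cover of `p̄`, and `s_p = Σ_{q ∈ Q} q`: for every
Grothendieck group `ι : M_{J_p} → Γ` of the archimedean component `M_{J_p}` of `s_p`,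
every realization `(G', j)` of the group `G'_p`, every incarnation
`φp : M_{J_p} → G'` of the map `x ↦ p + x`, the unique group homomorphism
`ψ = G(φ_p) : Γ → G'` with `ψ ∘ ι = φp` is surjective and its kernel is the cyclic
subgroup generated by `ι x` for some `x ∈ M_{J_p}`. -/
def AlmostIsoCondition (M : Type) [AddCommMonoid M] (p : M) (Q : Finset M) : Prop :=
  ∀ (Γ : Type) [AddCommGroup Γ],
    ∀ ι : AddHom (archComp (∑ q ∈ Q, (q : M))) Γ,
    IsGrothendieck (archComp (∑ q ∈ Q, (q : M))) Γ ι →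
    ∀ (G' : Type) [AddCommGroup G'], ∀ j : G' → M, GpStructure M p G' j →
    ∀ φp : AddHom (archComp (∑ q ∈ Q, (q : M))) G',
      (∀ a : archComp (∑ q ∈ Q, (q : M)), j (φp a) = p + (a : M)) →
    ∀ ψ : Γ →+ G', (∀ a, ψ (ι a) = φp a) →
      Function.Surjective ψ ∧
        ∃ x : archComp (∑ q ∈ Q, (q : M)), ψ.ker = AddSubgroup.zmultiples (ι x)

/-- An order-ideal of a commutative monoid. -/
def IsOrderIdeal {M : Type} [AddCommMonoid M] (S : Set M) : Prop :=
  (0 : M) ∈ S ∧ (∀ x y : M, x ∈ S → y ∈ S → x + y ∈ S) ∧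
    ∀ x y : M, algLE x y → y ∈ S → x ∈ S

/-- The order-ideal generated by a subset: the smallest order-ideal containing it. -/
def orderIdealGen {M : Type} [AddCommMonoid M] (X : Set M) : Set M :=
  ⋂₀ {S : Set M | IsOrderIdeal S ∧ X ⊆ S}

/-- The restriction graph `E_H` of a hereditary subset `H` of the vertices. -/
def restrictGraph (G : RowFiniteGraph) (H : Set G.V)
    (hher : ∀ e : G.E, G.s e ∈ H → G.r e ∈ H) : RowFiniteGraph where
  V := ↥H
  E := {e : G.E // G.s e ∈ H}
  countableV := by have := G.countableV; exact inferInstance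
  countableE := by have := G.countableE; exact inferInstance
  s := fun e => ⟨G.s e.1, e.2⟩
  r := fun e => ⟨G.r e.1, hher e.1 e.2⟩
  rowFinite := fun v => by
    have hsub : {e : {e : G.E // G.s e ∈ H} | (⟨G.s e.1, e.2⟩ : ↥H) = v}
        ⊆ Subtype.val ⁻¹' {e : G.E | G.s e = (v : G.V)} := by
      intro e he
      simpa [Subtype.ext_iff] using he
    exact Set.Finite.subset
      (Set.Finite.preimage (Subtype.val_injective.injOn) (G.rowFinite (v : G.V))) hsub

/-- The algebraic preorder as a `Preorder`. -/
abbrev algPreorder (M : Type) [AddCommMonoid M] : Preorder M where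
  le := algLE
  le_refl x := ⟨0, (add_zero x).symm⟩
  le_trans := by
    rintro x _ _ ⟨u, rfl⟩ ⟨v, rfl⟩
    exact ⟨u + v, add_assoc x u v⟩

section Preorder

variable {M : Type} [AddCommMonoid M]

theorem algLE.trans {x y z : M} (hxy : algLE x y) (hyz : algLE y z) : algLE x z :=
  (algPreorder M).le_trans _ _ _ hxy hyz

theorem algLE_add_right (x y : M) : algLE x (x + y) := ⟨y, rfl⟩

theorem algLE_add_left (x y : M) : algLE y (x + y) := ⟨x, add_comm x y⟩

theorem algLE.add_left {x y : M} (h : algLE x y) (z : M) : algLE (z + x) (z + y) := by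
  obtain ⟨w, rfl⟩ := h
  exact ⟨w, (add_assoc z x w).symm⟩

theorem algLE_sum_of_mem {Q : Finset M} {q : M} (hq : q ∈ Q) : algLE q (∑ r ∈ Q, r) := by
  classical
  exact ⟨∑ r ∈ Q.erase q, r, (Finset.add_sum_erase Q (fun r => r) hq).symm⟩

/-- The algebraic preorder of a finitely generated commutative monoid is a well-quasi-order. -/
theorem wellQuasiOrdered_algLE [AddMonoid.FG M] : WellQuasiOrdered (algLE (M := M)) := by
  obtain ⟨T, hT⟩ := (AddMonoid.FG.fg_top : (⊤ : AddSubmonoid M).FG)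
  have hrep : ∀ x : M, ∃ c : T → ℕ, ∑ t : T, c t • (t : M) = x := by
    intro x
    have hx : x ∈ AddSubmonoid.closure (T : Set M) := hT ▸ AddSubmonoid.mem_top x
    obtain ⟨c, -, hc⟩ := AddSubmonoid.mem_closure_finset.1 hx
    exact ⟨fun t => c t, by rw [← hc]; exact Finset.sum_coe_sort T fun t => c t • t⟩
  choose c hc using hrep
  intro f
  obtain ⟨m, n, hmn, h⟩ := wellQuasiOrdered_le (fun k => c (f k))
  refine ⟨m, n, hmn, ∑ t : T, (c (f n) t - c (f m) t) • (t : M), ?_⟩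
  rw [← hc (f m), ← hc (f n), ← Finset.sum_add_distrib]
  refine Finset.sum_congr rfl fun t _ => ?_
  rw [hc, hc, ← add_nsmul, Nat.add_sub_cancel' (h t)]

theorem wellFounded_classLT [AddMonoid.FG M] : WellFounded (classLT (M := M)) :=
  haveI : IsPreorder M algLE :=
    { refl := (algPreorder M).le_refl, trans := (algPreorder M).le_trans }
  (wellQuasiOrdered_algLE (M := M)).wellFounded

end Preorder

section Primes

variable {M : Type} [AddCommMonoid M]

theorem IsPrimeElem.congr {p q : M} (hp : IsPrimeElem p) (hpq : algLE p q) (hqp : algLE q p) :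
    IsPrimeElem q := by
  refine ⟨fun r hr => ?_, fun a b h => ?_⟩
  · obtain ⟨z, rfl⟩ := hpq
    exact hp.1 (z + r) (by rw [← add_assoc, hr])
  · exact (hp.2 a b (hpq.trans h)).imp hqp.trans hqp.trans

/-- In a finitely generated refinement monoid, an element outside an order-ideal dominates a
prime outside that order-ideal. -/
theorem exists_prime_algLE_notMem [AddMonoid.FG M] (href : IsRefinement M) {S : Set M}
    (hS : IsOrderIdeal S) {a : M} (ha : a ∉ S) : ∃ u, IsPrimeElem u ∧ algLE u a ∧ u ∉ S := by
  obtain ⟨u, ⟨hua, huS⟩, hmin⟩ := wellFounded_classLT.has_min {u : M | algLE u a ∧ u ∉ S}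
    ⟨a, ⟨0, (add_zero a).symm⟩, ha⟩
  have hle : ∀ v, algLE v u → v ∉ S → algLE u v := fun v hv hvS => by
    by_contra h
    exact hmin v ⟨hv.trans hua, hvS⟩ ⟨hv, h⟩
  refine ⟨u, ⟨fun q hq => huS (hS.2.2 u 0 ⟨q, hq.symm⟩ hS.1), ?_⟩, hua, huS⟩
  rintro c d ⟨z, hz⟩
  obtain ⟨w, x, y, t, hu, -, hc, hd⟩ := href u z c d hz.symm
  by_cases hw : w ∈ S
  · have hx : x ∉ S := fun hx => huS (hu ▸ hS.2.1 w x hw hx)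
    exact Or.inr ((hle x (hu ▸ algLE_add_left w x) hx).trans (hd ▸ algLE_add_right x t))
  · exact Or.inl ((hle w (hu ▸ algLE_add_right w x) hw).trans (hc ▸ algLE_add_right w y))

/-- A prime below a finite sum lies below one of the summands. -/
theorem IsPrimeElem.exists_mem_algLE_of_mem_closure {p : M} (hp : IsPrimeElem p) {T : Set M} {x : M}
    (hx : x ∈ AddSubmonoid.closure T) (hpx : algLE p x) :
    ∃ t ∈ T, algLE p t ∧ algLE t x := by
  induction hx using AddSubmonoid.closure_induction with
  | mem t ht => exact ⟨t, ht, hpx, 0, (add_zero t).symm⟩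
  | zero =>
    obtain ⟨z, hz⟩ := hpx
    exact (hp.1 z hz.symm).elim
  | add x y _ _ ihx ihy =>
    rcases hp.2 x y hpx with h | h
    · obtain ⟨t, ht, hpt, htx⟩ := ihx h
      exact ⟨t, ht, hpt, htx.trans (algLE_add_right x y)⟩
    · obtain ⟨t, ht, hpt, hty⟩ := ihy h
      exact ⟨t, ht, hpt, hty.trans (algLE_add_left x y)⟩

/-- A finitely generated commutative monoid has only finitely many classes of primes. -/
theorem exists_finite_prime_representatives (M : Type) [AddCommMonoid M] [AddMonoid.FG M] :
    ∃ T : Set M, T.Finite ∧ ∀ r : M, IsPrimeElem r → ∃ t ∈ T, algLE r t ∧ algLE t r := by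
  obtain ⟨T, hT⟩ := (AddMonoid.FG.fg_top : (⊤ : AddSubmonoid M).FG)
  refine ⟨T, T.finite_toSet, fun r hr => ?_⟩
  exact hr.exists_mem_algLE_of_mem_closure (hT ▸ AddSubmonoid.mem_top r)
    ⟨0, (add_zero r).symm⟩

/-- Every prime strictly below `p` lies below a prime in the lower cover of `p`. -/
theorem exists_inLowerCover [AddMonoid.FG M] {p r : M} (hr : IsPrimeElem r) (hrp : classLT r p) :
    ∃ t, InLowerCover p t ∧ algLE r t := by
  let _ := algPreorder M
  obtain ⟨T, hfin, hT⟩ := exists_finite_prime_representatives M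
  let A : Set M := {t ∈ T | IsPrimeElem t ∧ algLE r t ∧ classLT t p}
  have hmem : ∀ v, IsPrimeElem v → algLE r v → classLT v p →
      ∃ t ∈ A, algLE v t ∧ algLE t v := fun v hv hrv hvp => by
    obtain ⟨t, htT, hvt, htv⟩ := hT v hv
    exact ⟨t, ⟨htT, hv.congr hvt htv, hrv.trans hvt, htv.trans hvp.1,
      fun h => hvp.2 (h.trans htv)⟩, hvt, htv⟩
  obtain ⟨t₀, ht₀, -⟩ := hmem r hr ⟨0, (add_zero r).symm⟩ hrp
  obtain ⟨t, ht, hmax⟩ := (hfin.subset (Set.sep_subset T _) : A.Finite).exists_maximal ⟨t₀, ht₀⟩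
  refine ⟨t, ⟨ht.2.1, ht.2.2.2, ?_⟩, ht.2.2.1⟩
  rintro ⟨v, hv, htv, hvp⟩
  obtain ⟨v', hv'A, hvv', hv'v⟩ := hmem v hv (ht.2.2.1.trans htv.1) hvp
  exact htv.2 (hvv'.trans (hmax hv'A (htv.1.trans hvv')))

theorem IsPrimeElem.add_algLE_self {p q : M} (hp : IsPrimeElem p) (hq : classLT q p) :
    algLE (p + q) p := by
  obtain ⟨z, hz⟩ := hq.1
  obtain ⟨w, hw⟩ := (hp.2 q z ⟨0, by rw [← hz, add_zero]⟩).resolve_left hq.2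
  refine ⟨w, ?_⟩
  rw [add_comm p q, add_assoc, ← hw, ← hz]

end Primes

section Absorption

variable {M : Type} [AddCommMonoid M]

/-- The elements `x` with `p + x ≤ p` form an order-ideal. -/
theorem isOrderIdeal_add_algLE_self (p : M) : IsOrderIdeal {x : M | algLE (p + x) p} := by
  refine ⟨⟨0, by simp⟩, fun x y hx hy => ?_, fun x y hxy hy => (hxy.add_left p).trans hy⟩
  obtain ⟨u, hu⟩ := hx
  obtain ⟨v, hv⟩ := hy
  refine ⟨u + v, ?_⟩
  calc p = p + y + v := hv
    _ = p + x + u + y + v := by rw [← hu]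
    _ = p + (x + y) + (u + v) := by abel

theorem isOrderIdeal_algLE_nsmul (s : M) : IsOrderIdeal {x : M | ∃ n : ℕ, algLE x (n • s)} := by
  refine ⟨⟨0, 0, by simp⟩, ?_, fun x y hxy ⟨n, hn⟩ => ⟨n, hxy.trans hn⟩⟩
  rintro x y ⟨n, u, hu⟩ ⟨m, v, hv⟩
  exact ⟨n + m, u + v, by rw [add_nsmul, hu, hv]; abel⟩

theorem IsOrderIdeal.sum_mem {S : Set M} (hS : IsOrderIdeal S) {Q : Finset M}
    (hQ : ∀ q ∈ Q, q ∈ S) : ∑ q ∈ Q, q ∈ S :=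
  Finset.sum_induction _ (· ∈ S) hS.2.1 hS.1 hQ

theorem IsOrderIdeal.nsmul_mem {S : Set M} (hS : IsOrderIdeal S) {x : M} (hx : x ∈ S) (n : ℕ) :
    n • x ∈ S := by
  induction n with
  | zero => simpa using hS.1
  | succ n ih => simpa only [succ_nsmul] using hS.2.1 _ _ ih hx

variable {p : M} {Q : Finset M}

theorem add_sum_algLE_self (hp : IsPrimeElem p) (hQ : IsLowerCoverReps p Q) :
    algLE (p + ∑ q ∈ Q, q) p :=
  (isOrderIdeal_add_algLE_self p).sum_mem fun q hq => hp.add_algLE_self (hQ.1 q hq).2.1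

theorem add_algLE_self_of_mem_archComp (hp : IsPrimeElem p) (hQ : IsLowerCoverReps p Q) {x : M}
    (hx : x ∈ archComp (∑ q ∈ Q, q)) : algLE (p + x) p := by
  obtain ⟨n, -, -, -, hn, -⟩ := hx
  have hI := isOrderIdeal_add_algLE_self p
  exact hI.2.2 x _ hn (hI.nsmul_mem (add_sum_algLE_self hp hQ) n)

/-- An element absorbed by the free prime `p` lies in the order-ideal generated by the lower
cover of `p`. -/
theorem exists_algLE_nsmul_sum [AddMonoid.FG M] (href : IsRefinement M) (hfree : IsFreeElem p)
    (hQ : IsLowerCoverReps p Q) {y : M} (hy : algLE (p + y) p) :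
    ∃ n : ℕ, algLE y (n • ∑ q ∈ Q, q) := by
  by_contra hyS
  have hS := isOrderIdeal_algLE_nsmul (∑ q ∈ Q, q)
  obtain ⟨u, hu, huy, huS⟩ := exists_prime_algLE_notMem href hS hyS
  have hpu : ¬ algLE p u := fun h => by
    have h2 : algLE (2 • p) (1 • p) := by
      rw [two_nsmul, one_nsmul]
      exact ((h.trans huy).add_left p).trans hy
    exact absurd (hfree 2 1 h2) (by norm_num)
  obtain ⟨t, ht, hut⟩ := exists_inLowerCover hu
    ⟨huy.trans ((algLE_add_left p y).trans hy), hpu⟩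
  obtain ⟨q, hq, -, htq⟩ := hQ.2.2 t ht
  exact huS ⟨1, by simpa using hut.trans (htq.trans (algLE_sum_of_mem hq))⟩

theorem exists_mem_archComp_add_eq [AddMonoid.FG M] (href : IsRefinement M) (hp : IsPrimeElem p)
    (hfree : IsFreeElem p) (hQ : IsLowerCoverReps p Q) {a : M} (ha : algLE (p + a) p) :
    ∃ y ∈ archComp (∑ q ∈ Q, q), p + y = p + a := by
  obtain ⟨w, hw⟩ := add_sum_algLE_self hp hQ
  set s := ∑ q ∈ Q, q
  have hy : p + (s + (w + a)) = p + a := by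
    rw [← add_assoc, ← add_assoc, ← hw]
  obtain ⟨n, hn⟩ := exists_algLE_nsmul_sum href hfree hQ (hy ▸ ha : algLE (p + (s + (w + a))) p)
  refine ⟨s + (w + a), ⟨n + 1, 1, n.succ_pos, one_pos, ?_, ?_⟩, hy⟩
  · exact hn.trans ⟨s, succ_nsmul s n⟩
  · rw [one_nsmul]
    exact algLE_add_right s (w + a)

end Absorption

/-- Let `M` be a finitely generated conical refinement monoid and
`p` a free prime of `M` which is not minimal in the poset of primes. For any set `Q`
of representatives of the lower cover of `p̄`, with `s_p = Σ_{q ∈ Q} q` and `M_{J_p}`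
the archimedean component of `s_p`: every `p + x` with `x ∈ M_{J_p}` belongs to
`G'_p`, and the map `φ_p : M_{J_p} → G'_p`, `x ↦ p + x`, is a surjective semigroup
homomorphism onto the group `G'_p` (realized by any `(G', j)` as in `GpStructure`). -/
theorem phi_p_surjective (M : Type) [AddCommMonoid M] [AddMonoid.FG M]
    (hcon : IsConical M) (href : IsRefinement M)
    (p : M) (hprime : IsPrimeElem p) (hfree : IsFreeElem p)
    (hnonmin : ∃ q : M, IsPrimeElem q ∧ classLT q p)
    (Q : Finset M) (hQ : IsLowerCoverReps p Q) :
    (∀ x ∈ archComp (∑ q ∈ Q, (q : M)), (p + x) ∈ GpSet p) ∧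
    ∀ (G' : Type) [AddCommGroup G'], ∀ j : G' → M, GpStructure M p G' j →
      ∃ φp : AddHom (archComp (∑ q ∈ Q, (q : M))) G',
        (∀ a : archComp (∑ q ∈ Q, (q : M)), j (φp a) = p + (a : M)) ∧
        Function.Surjective φp := by
  refine ⟨fun x hx => ⟨x, rfl, add_algLE_self_of_mem_archComp hprime hQ hx⟩, ?_⟩
  intro G' _ j hj
  have hlift : ∀ a : archComp (∑ q ∈ Q, (q : M)), ∃ g : G', j g = p + (a : M) := fun a => by
    have ha : p + (a : M) ∈ Set.range j :=
      hj.range_eq ▸ ⟨a, rfl, add_algLE_self_of_mem_archComp hprime hQ a.2⟩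
    exact ha
  choose φ hφ using hlift
  refine ⟨⟨φ, fun a b => hj.inj ?_⟩, hφ, fun g => ?_⟩
  · rw [hφ, hj.map_add _ _ _ _ (hφ a) (hφ b), AddMemClass.coe_add]
  · have hg : j g ∈ GpSet p := hj.range_eq ▸ Set.mem_range_self g
    obtain ⟨α, hα, hle⟩ := hg
    obtain ⟨y, hy, hyα⟩ := exists_mem_archComp_add_eq href hprime hfree hQ (hα ▸ hle)
    exact ⟨⟨y, hy⟩, hj.inj ((hφ ⟨y, hy⟩).trans (hyα.trans hα.symm))⟩

end ArPardo
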